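/- arXiv:2407.05460 — 2 statements merged into one kernel-verified Lean document; each statement's English description precedes it below -/
import Mathlib

section
/- Fix ε ∈ (0,1/2). For the incremental-construction Markov chain (R_t, C_t, G_t) of size K and the stopping time τ_{εK} = inf{t ≥ 1 : G_t = ⌊εK⌋}, the rescaled stopping time τ_{εK}/K converges in probability, as K → ∞, to (1/2)·log(1/(1−2ε)). -/
open MeasureTheory Filter

noncomputable section

/-- One-step transition probability at time `t` of the incremental-construction
Markov chain `(R_t, C_t, G_t)` of size `K` (Algorithm 1 of the paper). -/
def transProb (K t : ℕ) (s s' : ℕ × ℕ × ℕ) : ℝ :=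
  let r : ℝ := s.1
  let c : ℝ := s.2.1
  let pR : ℝ := ((K : ℝ) - r) * K / ((K : ℝ) ^ 2 - t)
  let pC : ℝ := ((K : ℝ) - c) / K
  let pC' : ℝ := r * ((K : ℝ) - c) / (r * K - t)
  if s' = (s.1 + 1, s.2.1 + 1, s.2.2 + 1) then pR * pC
  else if s' = (s.1 + 1, s.2.1, s.2.2) then pR * (1 - pC)
  else if s' = (s.1, s.2.1 + 1, s.2.2) then (1 - pR) * pC'
  else if s' = (s.1, s.2.1, s.2.2) then (1 - pR) * (1 - pC')
  else 0

lemma measure_eq_tsum_fiber {Ω β : Type*} [MeasurableSpace Ω] [MeasurableSpace β]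
    [MeasurableSingletonClass β] [Countable β] (μ : Measure Ω) {p : Ω → β} (hp : Measurable p)
    {A : Set Ω} (hA : MeasurableSet A) : μ A = ∑' q, μ (p ⁻¹' {q} ∩ A) := by
  rw [← measure_iUnion]
  · congr 1
    ext ω
    simp
  · intro i j hij
    refine Set.disjoint_left.2 ?_
    rintro ω ⟨h1, -⟩ ⟨h2, -⟩
    exact hij (h1.symm.trans h2)
  · exact fun q => (hp (measurableSet_singleton q)).inter hA

lemma lintegral_comp_eq_tsum {Ω β : Type*} [MeasurableSpace Ω] [MeasurableSpace β]
    [MeasurableSingletonClass β] [Countable β] (μ : Measure Ω) {p : Ω → β} (hp : Measurable p)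
    (f : β → ENNReal) : ∫⁻ ω, f (p ω) ∂μ = ∑' q, f q * μ (p ⁻¹' {q}) := by
  rw [← lintegral_map (measurable_of_countable f) hp, lintegral_countable']
  exact tsum_congr fun q => by rw [Measure.map_apply hp (measurableSet_singleton q)]

/-- The finite-dimensional distributions of the incremental-construction chain of size `K`. -/
def HasChainLaw {Ω : Type*} [MeasurableSpace Ω] (μ : Measure Ω) (X : ℕ → Ω → ℕ × ℕ × ℕ)
    (K : ℕ) : Prop :=
  ∀ T, 1 ≤ T → T ≤ K ^ 2 → ∀ traj : ℕ → ℕ × ℕ × ℕ,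
    μ {ω | ∀ t, 1 ≤ t → t ≤ T → X t ω = traj t} =
      ENNReal.ofReal (if traj 1 = (1, 1, 1) then
        ∏ t ∈ Finset.Ico 1 T, transProb K t (traj t) (traj (t + 1)) else 0)

section Chain

variable {Ω : Type*} [MeasurableSpace Ω] {μ : Measure Ω} {X : ℕ → Ω → ℕ × ℕ × ℕ} {K t : ℕ}

lemma HasChainLaw.measure_path_succ (h : HasChainLaw μ X K) (ht : 1 ≤ t) (htK : t + 1 ≤ K ^ 2)
    (traj : ℕ → ℕ × ℕ × ℕ) (s' : ℕ × ℕ × ℕ) :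
    μ ({ω | ∀ u, 1 ≤ u → u ≤ t → X u ω = traj u} ∩ {ω | X (t + 1) ω = s'}) =
      μ {ω | ∀ u, 1 ≤ u → u ≤ t → X u ω = traj u} *
        ENNReal.ofReal (transProb K t (traj t) s') := by
  have hset : {ω | ∀ u, 1 ≤ u → u ≤ t → X u ω = traj u} ∩ {ω | X (t + 1) ω = s'} =
      {ω | ∀ u, 1 ≤ u → u ≤ t + 1 → X u ω = Function.update traj (t + 1) s' u} := by
    ext ω
    constructor
    · rintro ⟨h1, h2⟩ u hu hut
      rcases Nat.lt_or_ge t u with hlt | hle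
      · obtain rfl : u = t + 1 := by omega
        simpa using h2
      · rw [Function.update_of_ne (by omega)]
        exact h1 u hu hle
    · intro h1
      refine ⟨fun u hu hut => ?_, ?_⟩
      · have := h1 u hu (by omega)
        rwa [Function.update_of_ne (by omega)] at this
      · simpa using h1 (t + 1) (by omega) le_rfl
  have hprod : ∏ u ∈ Finset.Ico 1 (t + 1), transProb K u (Function.update traj (t + 1) s' u)
        (Function.update traj (t + 1) s' (u + 1)) =
      (∏ u ∈ Finset.Ico 1 t, transProb K u (traj u) (traj (u + 1))) *
        transProb K t (traj t) s' := by
    rw [Finset.prod_Ico_succ_top ht]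
    congr 1
    · refine Finset.prod_congr rfl fun u hu => ?_
      rw [Finset.mem_Ico] at hu
      rw [Function.update_of_ne (by omega), Function.update_of_ne (by omega)]
    · rw [Function.update_of_ne (by omega), Function.update_self]
  have hT := h t ht (by omega) traj
  rcases le_or_gt 0 (if traj 1 = (1, 1, 1) then
      ∏ u ∈ Finset.Ico 1 t, transProb K u (traj u) (traj (u + 1)) else 0) with hP | hP
  · rw [hT, ← ENNReal.ofReal_mul hP, hset, h (t + 1) (by omega) htK, hprod,
      Function.update_of_ne (by omega)]
    congr 1
    split_ifs <;> simp
  · rw [ENNReal.ofReal_of_nonpos hP.le] at hT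
    rw [hT, zero_mul]
    exact measure_mono_null Set.inter_subset_left hT

lemma HasChainLaw.measure_pair (h : HasChainLaw μ X K) (hX : ∀ u, Measurable (X u))
    (ht : 1 ≤ t) (htK : t + 1 ≤ K ^ 2) (s s' : ℕ × ℕ × ℕ) :
    μ (X t ⁻¹' {s} ∩ X (t + 1) ⁻¹' {s'}) =
      μ (X t ⁻¹' {s}) * ENNReal.ofReal (transProb K t s s') := by
  have hm : ∀ u r, MeasurableSet (X u ⁻¹' {r}) := fun u r => hX u (measurableSet_singleton r)
  let p : Ω → Fin t → ℕ × ℕ × ℕ := fun ω i => X (i + 1) ω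
  have hp : Measurable p := measurable_pi_lambda _ fun i => hX _
  rw [measure_eq_tsum_fiber μ hp ((hm t s).inter (hm (t + 1) s')),
    measure_eq_tsum_fiber μ hp (hm t s), ← ENNReal.tsum_mul_right]
  refine tsum_congr fun q => ?_
  let traj : ℕ → ℕ × ℕ × ℕ := fun u => if hu : u - 1 < t then q ⟨u - 1, hu⟩ else (0, 0, 0)
  have hpre : p ⁻¹' {q} = {ω | ∀ u, 1 ≤ u → u ≤ t → X u ω = traj u} := by
    ext ω
    constructor
    · intro hω u hu hut
      have hω' : p ω = q := hω
      simp only [traj]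
      rw [dif_pos (by omega), ← hω']
      simp only [p]
      congr 2
      omega
    · intro hω
      funext i
      have := hω (i + 1) (by omega) (by omega)
      simpa [p, traj] using this
  by_cases hs : traj t = s
  · have hsub : p ⁻¹' {q} ⊆ X t ⁻¹' {s} := by
      rw [hpre, ← hs]
      exact fun ω hω => hω t ht le_rfl
    rw [← Set.inter_assoc, Set.inter_eq_left.2 hsub, hpre, ← hs]
    exact h.measure_path_succ ht htK traj s'
  · have hdis : p ⁻¹' {q} ∩ X t ⁻¹' {s} = ∅ := by
      rw [hpre]
      refine Set.eq_empty_of_forall_notMem ?_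
      rintro ω ⟨h1, h2⟩
      exact hs ((h1 t ht le_rfl).symm.trans h2)
    rw [← Set.inter_assoc, hdis]
    simp

lemma HasChainLaw.lintegral_succ (h : HasChainLaw μ X K) (hX : ∀ u, Measurable (X u))
    (ht : 1 ≤ t) (htK : t + 1 ≤ K ^ 2) (f : ℕ × ℕ × ℕ → ENNReal) :
    ∫⁻ ω, f (X (t + 1) ω) ∂μ =
      ∫⁻ ω, ∑' s', ENNReal.ofReal (transProb K t (X t ω) s') * f s' ∂μ := by
  rw [lintegral_comp_eq_tsum μ (hX (t + 1)), lintegral_comp_eq_tsum μ (hX t)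
    (fun s => ∑' s', ENNReal.ofReal (transProb K t s s') * f s')]
  simp_rw [← ENNReal.tsum_mul_right]
  rw [ENNReal.tsum_comm]
  refine tsum_congr fun s' => ?_
  rw [measure_eq_tsum_fiber μ (hX t) (hX (t + 1) (measurableSet_singleton s')),
    ← ENNReal.tsum_mul_left]
  refine tsum_congr fun s => ?_
  rw [h.measure_pair hX ht htK]
  ring

lemma HasChainLaw.ae_transProb_pos (h : HasChainLaw μ X K) (hX : ∀ u, Measurable (X u))
    (ht : 1 ≤ t) (htK : t + 1 ≤ K ^ 2) :
    ∀ᵐ ω ∂μ, 0 < transProb K t (X t ω) (X (t + 1) ω) := by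
  have : ∀ᵐ ω ∂μ, ∀ q : (ℕ × ℕ × ℕ) × (ℕ × ℕ × ℕ), X t ω = q.1 → X (t + 1) ω = q.2 →
      0 < transProb K t q.1 q.2 := by
    rw [ae_all_iff]
    rintro ⟨s, s'⟩
    rcases lt_or_ge 0 (transProb K t s s') with hpos | hneg
    · exact Eventually.of_forall fun ω _ _ => hpos
    · have h0 : μ (X t ⁻¹' {s} ∩ X (t + 1) ⁻¹' {s'}) = 0 := by
        rw [h.measure_pair hX ht htK, ENNReal.ofReal_of_nonpos hneg, mul_zero]
      filter_upwards [measure_eq_zero_iff_ae_notMem.1 h0] with ω hω h1 h2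
      exact absurd ⟨h1, h2⟩ hω
  filter_upwards [this] with ω hω
  exact hω (_, _) rfl rfl

lemma HasChainLaw.ae_start (h : HasChainLaw μ X K) [IsProbabilityMeasure μ]
    (hX : ∀ u, Measurable (X u)) (hK : 2 ≤ K) : ∀ᵐ ω ∂μ, X 1 ω = (1, 1, 1) := by
  have h1 := h 1 le_rfl (Nat.one_le_pow _ _ (by omega)) (fun _ => (1, 1, 1))
  have h2 : {ω | ∀ t, 1 ≤ t → t ≤ 1 → X t ω = (1, 1, 1)} = {ω | X 1 ω = (1, 1, 1)} := by
    ext ω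
    constructor
    · exact fun hω => hω 1 le_rfl le_rfl
    · intro hω t ht ht'
      obtain rfl : t = 1 := by omega
      exact hω
  rw [h2] at h1
  refine (prob_compl_eq_zero_iff (hX 1 (measurableSet_singleton _))).2 ?_
  have h3 : μ {ω | X 1 ω = (1, 1, 1)} = 1 := by simpa using h1
  exact h3

end Chain

/-- The deterministic constraints satisfied at time `t` by the states the chain can visit. -/
structure Reachable (K t : ℕ) (s : ℕ × ℕ × ℕ) : Prop where
  one_le_row : 1 ≤ s.1
  row_le : s.1 ≤ K
  col_le : s.2.1 ≤ K
  green_le : s.2.2 ≤ s.1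
  time_le : t ≤ s.1 * s.2.1

lemma Reachable.succ {K t : ℕ} {s s' : ℕ × ℕ × ℕ} (h : Reachable K t s) (ht : 1 ≤ t)
    (htK : t + 1 ≤ K ^ 2) (hpos : 0 < transProb K t s s') :
    Reachable K (t + 1) s' ∧ s.2.2 ≤ s'.2.2 ∧ s'.2.2 ≤ s.2.2 + 1 := by
  obtain ⟨r, c, g⟩ := s
  obtain ⟨h1, h2, h3, h4, h5⟩ := h
  simp only at h1 h2 h3 h4 h5
  have hc : 1 ≤ c := by
    rcases Nat.eq_zero_or_pos c with rfl | hc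
    · omega
    · exact hc
  have hne : ∀ {m : ℕ}, m ≤ K → (K : ℝ) - m ≠ 0 → m + 1 ≤ K := by
    intro m hm hm'
    refine Nat.lt_of_le_of_ne hm ?_
    rintro rfl
    simp at hm'
  unfold transProb at hpos
  simp only at hpos
  split_ifs at hpos with e1 e2 e3 e4
  · subst e1
    have hr := hne h2 (fun h0 => by simp [h0] at hpos)
    have hc' := hne h3 (fun h0 => by simp [h0] at hpos)
    refine ⟨⟨by simp, hr, hc', by simpa using h4, ?_⟩, by simp, by simp⟩
    simp only
    nlinarith
  · subst e2
    have hr := hne h2 (fun h0 => by simp [h0] at hpos)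
    refine ⟨⟨by simp, hr, h3, by simp only; omega, ?_⟩, by simp, by simp⟩
    simp only
    nlinarith
  · subst e3
    have hc' := hne h3 (fun h0 => by simp [h0] at hpos)
    refine ⟨⟨h1, h2, hc', h4, ?_⟩, by simp, by simp⟩
    simp only
    nlinarith
  · subst e4
    refine ⟨⟨h1, h2, h3, h4, ?_⟩, by simp, by simp⟩
    simp only
    refine Nat.lt_of_le_of_ne h5 ?_
    rintro rfl
    have hr0 : (r : ℝ) ≠ 0 := by positivity
    rcases h3.lt_or_eq with hlt | rfl
    · have hc0 : (K : ℝ) - c ≠ 0 := sub_ne_zero.2 (by exact_mod_cast hlt.ne')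
      have : (r : ℝ) * (K - c) / (r * K - (r * c : ℕ)) = 1 := by
        rw [div_eq_one_iff_eq]
        · push_cast; ring
        · push_cast
          rw [← mul_sub]
          exact mul_ne_zero hr0 hc0
      rw [this] at hpos
      simp at hpos
    · have hrc : r < c := by
        by_contra! hge
        have : c ^ 2 ≤ r * c := by nlinarith
        omega
      have hc0 : (c : ℝ) ≠ 0 := by positivity
      have hd : (c : ℝ) - r ≠ 0 := sub_ne_zero.2 (by exact_mod_cast hrc.ne')
      have : ((c : ℝ) - r) * c / ((c : ℝ) ^ 2 - (r * c : ℕ)) = 1 := by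
        rw [div_eq_one_iff_eq]
        · push_cast; ring
        · push_cast
          have : (c : ℝ) ^ 2 - r * c = (c - r) * c := by ring
          rw [this]
          exact mul_ne_zero hd hc0
      rw [this] at hpos
      simp at hpos
  · exact absurd hpos (lt_irrefl 0)

lemma HasChainLaw.ae_reachable {Ω : Type*} [MeasurableSpace Ω] {μ : Measure Ω}
    [IsProbabilityMeasure μ] {X : ℕ → Ω → ℕ × ℕ × ℕ} {K t : ℕ} (h : HasChainLaw μ X K)
    (hX : ∀ u, Measurable (X u)) (hK : 2 ≤ K) (ht : 1 ≤ t) (htK : t ≤ K ^ 2) :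
    ∀ᵐ ω ∂μ, Reachable K t (X t ω) := by
  induction t, ht using Nat.le_induction with
  | base =>
    filter_upwards [h.ae_start hX hK] with ω hω
    rw [hω]
    exact ⟨le_rfl, by simp only; omega, by simp only; omega, le_rfl, le_rfl⟩
  | succ t ht ih =>
    filter_upwards [ih (by omega), h.ae_transProb_pos hX ht htK] with ω h1 h2
    exact (h1.succ ht htK h2).1

lemma Reachable.transProb_values {K t : ℕ} {r c g : ℕ} (h : Reachable K t (r, c, g))
    (htK : t + 1 ≤ K ^ 2) :
    transProb K t (r, c, g) (r + 1, c + 1, g + 1) =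
        ((K : ℝ) - r) * (K - c) / ((K : ℝ) ^ 2 - t) ∧
      transProb K t (r, c, g) (r + 1, c, g) = ((K : ℝ) - r) * c / ((K : ℝ) ^ 2 - t) ∧
      transProb K t (r, c, g) (r, c + 1, g) = (r : ℝ) * (K - c) / ((K : ℝ) ^ 2 - t) ∧
      transProb K t (r, c, g) (r, c, g) = ((r : ℝ) * c - t) / ((K : ℝ) ^ 2 - t) := by
  obtain ⟨h1, h2, h3, h4, h5⟩ := h
  simp only at h1 h2 h3 h4 h5
  have hK0 : (K : ℝ) ≠ 0 := by
    have : 0 < K := by omega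
    positivity
  have hD : (K : ℝ) ^ 2 - t ≠ 0 := by
    have : ((t + 1 : ℕ) : ℝ) ≤ ((K ^ 2 : ℕ) : ℝ) := by exact_mod_cast htK
    push_cast at this
    intro h0
    linarith
  have hcomp : 1 - ((K : ℝ) - r) * K / ((K : ℝ) ^ 2 - t) =
      ((r : ℝ) * K - t) / ((K : ℝ) ^ 2 - t) := by
    field_simp
    ring
  have hcol : (r : ℝ) * K - t = 0 → (c : ℝ) = K := by
    intro h0
    have h0' : r * K = t := by exact_mod_cast sub_eq_zero.1 h0
    have : c = K := by nlinarith
    exact_mod_cast this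
  refine ⟨?_, ?_, ?_, ?_⟩
  · simp [transProb]
    field_simp
  · simp [transProb]
    field_simp
    ring
  · simp only [transProb, hcomp]
    simp
    by_cases h0 : (r : ℝ) * K - t = 0
    · simp [h0, hcol h0]
    · field_simp
  · simp only [transProb, hcomp]
    simp
    by_cases h0 : (r : ℝ) * K - t = 0
    · rw [hcol h0, h0]
      simp
    · field_simp
      ring

lemma Reachable.tsum_transProb_mul {K t : ℕ} {r c g : ℕ} (h : Reachable K t (r, c, g))
    (htK : t + 1 ≤ K ^ 2) (f : ℕ × ℕ × ℕ → ℝ) (hf : ∀ s, 0 ≤ f s) :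
    ∑' s', ENNReal.ofReal (transProb K t (r, c, g) s') * ENNReal.ofReal (f s') =
      ENNReal.ofReal
        (((K : ℝ) - r) * (K - c) / ((K : ℝ) ^ 2 - t) * f (r + 1, c + 1, g + 1) +
          ((K : ℝ) - r) * c / ((K : ℝ) ^ 2 - t) * f (r + 1, c, g) +
          (r : ℝ) * (K - c) / ((K : ℝ) ^ 2 - t) * f (r, c + 1, g) +
          ((r : ℝ) * c - t) / ((K : ℝ) ^ 2 - t) * f (r, c, g)) := by
  obtain ⟨p1, p2, p3, p4⟩ := h.transProb_values htK
  obtain ⟨h1, h2, h3, h4, h5⟩ := h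
  simp only at h1 h2 h3 h4 h5
  have hD : 0 < (K : ℝ) ^ 2 - t := by
    have : ((t + 1 : ℕ) : ℝ) ≤ ((K ^ 2 : ℕ) : ℝ) := by exact_mod_cast htK
    push_cast at this
    linarith
  have hr : (0 : ℝ) ≤ (K : ℝ) - r := sub_nonneg.2 (by exact_mod_cast h2)
  have hc : (0 : ℝ) ≤ (K : ℝ) - c := sub_nonneg.2 (by exact_mod_cast h3)
  have hrc : (0 : ℝ) ≤ (r : ℝ) * c - t := sub_nonneg.2 (by exact_mod_cast h5)
  have f1 := hf (r + 1, c + 1, g + 1)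
  have f2 := hf (r + 1, c, g)
  have f3 := hf (r, c + 1, g)
  have f4 := hf (r, c, g)
  rw [tsum_eq_sum (s := {(r + 1, c + 1, g + 1), (r + 1, c, g), (r, c + 1, g), (r, c, g)})]
  · rw [Finset.sum_insert (by simp), Finset.sum_insert (by simp), Finset.sum_insert (by simp),
      Finset.sum_singleton, p1, p2, p3, p4, ← ENNReal.ofReal_mul (by positivity),
      ← ENNReal.ofReal_mul (by positivity), ← ENNReal.ofReal_mul (by positivity),
      ← ENNReal.ofReal_mul (by positivity), ← ENNReal.ofReal_add (by positivity) (by positivity),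
      ← ENNReal.ofReal_add (by positivity) (by positivity),
      ← ENNReal.ofReal_add (by positivity) (by positivity)]
    congr 1
    ring
  · intro s' hs'
    simp only [Finset.mem_insert, Finset.mem_singleton, not_or] at hs'
    obtain ⟨e1, e2, e3, e4⟩ := hs'
    simp [transProb, e1, e2, e3, e4]

/-- Deviation of `(K - R)(K - C) / K` from its fluid limit `K exp (-2t/K)`. -/
def emptyDev (K t : ℕ) (s : ℕ × ℕ × ℕ) : ℝ :=
  ((K : ℝ) - s.1) * (K - s.2.1) / K - K * Real.exp (-(2 / K) * t)

/-- Deviation of the fluid invariant `G + (K - R)(K - C) / (2K)` from its limit value `K / 2`. -/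
def invariantDev (K : ℕ) (s : ℕ × ℕ × ℕ) : ℝ :=
  s.2.2 + ((K : ℝ) - s.1) * (K - s.2.1) / (2 * K) - K / 2

/-- The quadratic Lyapunov function controlling the deviation from the fluid limit. -/
def lyapunov (K t : ℕ) (s : ℕ × ℕ × ℕ) : ℝ :=
  emptyDev K t s ^ 2 + invariantDev K s ^ 2

lemma four_point_sq_le {p₁ p₂ p₃ p₄ x₁ x₂ x₃ x₄ v d : ℝ} (h1 : 0 ≤ p₁) (h2 : 0 ≤ p₂)
    (h3 : 0 ≤ p₃) (h4 : 0 ≤ p₄) (hsum : p₁ + p₂ + p₃ + p₄ = 1) (hx1 : |x₁| ≤ 3) (hx2 : |x₂| ≤ 3)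
    (hx3 : |x₃| ≤ 3) (hx4 : |x₄| ≤ 3) (hd : p₁ * x₁ + p₂ * x₂ + p₃ * x₃ + p₄ * x₄ = d) :
    p₁ * (v + x₁) ^ 2 + p₂ * (v + x₂) ^ 2 + p₃ * (v + x₃) ^ 2 + p₄ * (v + x₄) ^ 2 ≤
      v ^ 2 + 2 * (v * d) + 9 := by
  have hsq : ∀ {x : ℝ}, |x| ≤ 3 → x ^ 2 ≤ 9 := by
    intro x hx
    obtain ⟨ha, hb⟩ := abs_le.1 hx
    nlinarith
  have e1 := mul_le_mul_of_nonneg_left (hsq hx1) h1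
  have e2 := mul_le_mul_of_nonneg_left (hsq hx2) h2
  have e3 := mul_le_mul_of_nonneg_left (hsq hx3) h3
  have e4 := mul_le_mul_of_nonneg_left (hsq hx4) h4
  have key : p₁ * (v + x₁) ^ 2 + p₂ * (v + x₂) ^ 2 + p₃ * (v + x₃) ^ 2 + p₄ * (v + x₄) ^ 2 =
      v ^ 2 * (p₁ + p₂ + p₃ + p₄) + 2 * (v * d) +
        (p₁ * x₁ ^ 2 + p₂ * x₂ ^ 2 + p₃ * x₃ ^ 2 + p₄ * x₄ ^ 2) := by
    rw [← hd]
    ring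
  rw [key, hsum]
  linarith

/-- The empty-cell deviation drifts towards zero up to an error of order `1 / k`. -/
lemma emptyDev_drift_le {k t L u E φ : ℝ} (hk : 1 ≤ k) (ht : 0 ≤ t) (htL : t ≤ L * k)
    (hkL : 2 * L ≤ k) (hu0 : 0 ≤ u) (huk : u ≤ k) (hE0 : 0 ≤ E) (hEk : E ≤ k)
    (hφ1 : 2 / k - 2 / k ^ 2 ≤ φ) (hφ2 : φ ≤ 2 / k) :
    (u - E) * (-u * (2 * k - 1) / (k ^ 2 - t) + E * φ) ≤ 4 * L + 4 := by
  have hD : k ^ 2 / 2 ≤ k ^ 2 - t := by nlinarith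
  have hk2 : 0 < k ^ 2 := by positivity
  have hDpos : 0 < k ^ 2 - t := by linarith
  have hL : 0 ≤ L := by
    by_contra! hneg
    nlinarith
  have hκ0 : 2 / k - (2 * k - 1) / (k ^ 2 - t) = (k - 2 * t) / (k * (k ^ 2 - t)) := by
    field_simp
    ring
  have hκ1 : |(k - 2 * t) / (k * (k ^ 2 - t))| ≤ (4 * L + 2) / k ^ 2 := by
    rw [abs_div, abs_of_pos (show 0 < k * (k ^ 2 - t) by positivity), div_le_div_iff₀
      (by positivity) hk2]
    have : |k - 2 * t| ≤ (2 * L + 1) * k := by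
      rw [abs_le]
      constructor <;> nlinarith
    calc |k - 2 * t| * k ^ 2 ≤ (2 * L + 1) * k * k ^ 2 := by gcongr
      _ = (4 * L + 2) * (k * (k ^ 2 / 2)) := by ring
      _ ≤ (4 * L + 2) * (k * (k ^ 2 - t)) := by gcongr
  have hκ : |φ - (2 * k - 1) / (k ^ 2 - t)| ≤ (4 * L + 4) / k ^ 2 := by
    rw [← hκ0] at hκ1
    obtain ⟨ha, hb⟩ := abs_le.1 hκ1
    have hsplit : (4 * L + 4) / k ^ 2 = (4 * L + 2) / k ^ 2 + 2 / k ^ 2 := by ring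
    have : 0 ≤ 2 / k ^ 2 := by positivity
    rw [abs_le]
    constructor <;> linarith
  have hV : |u - E| ≤ k := by
    rw [abs_le]
    constructor <;> linarith
  have heq : (u - E) * (-u * (2 * k - 1) / (k ^ 2 - t) + E * φ) =
      -((u - E) ^ 2 * ((2 * k - 1) / (k ^ 2 - t))) +
        (u - E) * E * (φ - (2 * k - 1) / (k ^ 2 - t)) := by ring
  have hneg : 0 ≤ (u - E) ^ 2 * ((2 * k - 1) / (k ^ 2 - t)) :=
    mul_nonneg (sq_nonneg _) (div_nonneg (by linarith) hDpos.le)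
  have hmain : (u - E) * E * (φ - (2 * k - 1) / (k ^ 2 - t)) ≤ 4 * L + 4 := by
    refine (le_abs_self _).trans ?_
    rw [abs_mul, abs_mul, abs_of_nonneg hE0]
    calc |u - E| * E * |φ - (2 * k - 1) / (k ^ 2 - t)| ≤ k * k * ((4 * L + 4) / k ^ 2) := by
          gcongr
      _ = 4 * L + 4 := by field_simp
  rw [heq]
  linarith

lemma one_sub_exp_bounds {k : ℝ} (hk : 1 ≤ k) :
    2 / k - 2 / k ^ 2 ≤ 1 - Real.exp (-(2 / k)) ∧ 1 - Real.exp (-(2 / k)) ≤ 2 / k := by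
  have hx : 0 ≤ 2 / k := by positivity
  constructor
  · have := Real.quadratic_le_exp_of_nonneg hx
    have h1 : Real.exp (-(2 / k)) * (1 + 2 / k + (2 / k) ^ 2 / 2) ≤ 1 := by
      calc _ ≤ Real.exp (-(2 / k)) * Real.exp (2 / k) := by gcongr
        _ = 1 := by rw [← Real.exp_add]; simp
    have h2 : 1 ≤ (1 - 2 / k + (2 / k) ^ 2 / 2) * (1 + 2 / k + (2 / k) ^ 2 / 2) := by
      have : (1 - 2 / k + (2 / k) ^ 2 / 2) * (1 + 2 / k + (2 / k) ^ 2 / 2) =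
        1 + (2 / k) ^ 4 / 4 := by ring
      rw [this]
      have : 0 ≤ (2 / k) ^ 4 / 4 := by positivity
      linarith
    have h3 := le_of_mul_le_mul_right (h1.trans h2) (by positivity)
    have h4 : (2 / k) ^ 2 / 2 = 2 / k ^ 2 := by ring
    linarith
  · have := Real.add_one_le_exp (-(2 / k))
    linarith

set_option maxHeartbeats 400000 in
lemma Reachable.lyapunov_step {K t : ℕ} {r c g : ℕ} {L : ℝ} (h : Reachable K t (r, c, g))
    (htK : t + 1 ≤ K ^ 2) (htL : (t : ℝ) ≤ L * K) (hKL : 2 * L ≤ K) :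
    ((K : ℝ) - r) * (K - c) / ((K : ℝ) ^ 2 - t) * lyapunov K (t + 1) (r + 1, c + 1, g + 1) +
      ((K : ℝ) - r) * c / ((K : ℝ) ^ 2 - t) * lyapunov K (t + 1) (r + 1, c, g) +
      (r : ℝ) * (K - c) / ((K : ℝ) ^ 2 - t) * lyapunov K (t + 1) (r, c + 1, g) +
      ((r : ℝ) * c - t) / ((K : ℝ) ^ 2 - t) * lyapunov K (t + 1) (r, c, g) ≤
    lyapunov K t (r, c, g) + (8 * L + 29) := by
  obtain ⟨h1, h2, h3, h4, h5⟩ := h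
  simp only at h1 h2 h3 h4 h5
  have hD : 0 < (K : ℝ) ^ 2 - t := by
    have : ((t + 1 : ℕ) : ℝ) ≤ ((K ^ 2 : ℕ) : ℝ) := by exact_mod_cast htK
    push_cast at this
    linarith
  have hk : (1 : ℝ) ≤ K := by exact_mod_cast h1.trans h2
  have ha : (0 : ℝ) ≤ (K : ℝ) - r := sub_nonneg.2 (by exact_mod_cast h2)
  have hb : (0 : ℝ) ≤ (K : ℝ) - c := sub_nonneg.2 (by exact_mod_cast h3)
  have hrc : (0 : ℝ) ≤ (r : ℝ) * c - t := sub_nonneg.2 (by exact_mod_cast h5)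
  have hg : (g : ℝ) ≤ r := by exact_mod_cast h4
  have hr0 : (0 : ℝ) ≤ r := by positivity
  have hc0 : (0 : ℝ) ≤ c := by positivity
  have hg0 : (0 : ℝ) ≤ g := by positivity
  have ht0 : (0 : ℝ) ≤ t := by positivity
  set k : ℝ := (K : ℝ) with hkdef
  set E : ℝ := k * Real.exp (-(2 / k) * t) with hE
  set φ : ℝ := 1 - Real.exp (-(2 / k)) with hφ
  obtain ⟨hφ1, hφ2⟩ := one_sub_exp_bounds hk
  have hφ0 : 0 ≤ φ := by
    have : Real.exp (-(2 / k)) ≤ 1 := Real.exp_le_one_iff.2 (by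
      have : 0 ≤ 2 / k := by positivity
      linarith)
    rw [hφ]
    linarith
  have hE0 : 0 ≤ E := by positivity
  have hEk : E ≤ k := by
    have : Real.exp (-(2 / k) * t) ≤ 1 := Real.exp_le_one_iff.2 (by
      have : 0 ≤ 2 / k * t := by positivity
      linarith)
    rw [hE]
    nlinarith
  have hEsucc : k * Real.exp (-(2 / k) * ((t + 1 : ℕ) : ℝ)) = E - E * φ := by
    rw [hE, hφ]
    push_cast
    rw [mul_add, Real.exp_add]
    ring_nf
  have hw0 : 0 ≤ E * φ := by positivity
  have hw2 : E * φ ≤ 2 := by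
    calc E * φ ≤ k * (2 / k) := by gcongr
      _ = 2 := by field_simp
  set u : ℝ := (k - r) * (k - c) / k with hu
  have hu0 : 0 ≤ u := by positivity
  have huk : u ≤ k := by
    rw [hu, div_le_iff₀ (by positivity)]
    nlinarith
  have hsum : (k - r) * (k - c) / (k ^ 2 - t) + (k - r) * c / (k ^ 2 - t) +
      r * (k - c) / (k ^ 2 - t) + (r * c - t) / (k ^ 2 - t) = 1 := by
    field_simp
    ring
  have habound : ∀ x : ℝ, -1 * k ≤ x → x ≤ 2 * k → |-(x / k) + E * φ| ≤ 3 := by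
    intro x hx1 hx2
    have e1 : -1 ≤ x / k := by rwa [le_div_iff₀ (by positivity)]
    have e2 : x / k ≤ 2 := by rwa [div_le_iff₀ (by positivity)]
    rw [abs_le]
    constructor <;> linarith
  have hbbound : ∀ x : ℝ, -1 * k ≤ x → x ≤ 2 * k → |1 - x / (2 * k)| ≤ 3 ∧ |-(x / (2 * k))| ≤ 3 := by
    intro x hx1 hx2
    have e1 : -1 ≤ x / (2 * k) := by
      rw [le_div_iff₀ (by positivity)]
      linarith
    have e2 : x / (2 * k) ≤ 2 := by
      rw [div_le_iff₀ (by positivity)]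
      linarith
    constructor <;> rw [abs_le] <;> constructor <;> linarith
  have hV := four_point_sq_le (v := u - E) (d := -u * (2 * k - 1) / (k ^ 2 - t) + E * φ)
    (x₁ := -(((k - r) + (k - c) - 1) / k) + E * φ) (x₂ := -((k - c) / k) + E * φ)
    (x₃ := -((k - r) / k) + E * φ) (x₄ := -(0 / k) + E * φ)
    (p₁ := (k - r) * (k - c) / (k ^ 2 - t)) (p₂ := (k - r) * c / (k ^ 2 - t))
    (p₃ := r * (k - c) / (k ^ 2 - t)) (p₄ := (r * c - t) / (k ^ 2 - t))
    (by positivity) (by positivity) (by positivity) (by positivity) hsum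
    (habound _ (by linarith) (by linarith)) (habound _ (by linarith) (by linarith))
    (habound _ (by linarith) (by linarith)) (habound _ (by linarith) (by linarith))
    (by
      rw [hu]
      field_simp
      ring)
  have hdrift := emptyDev_drift_le hk ht0 htL hKL hu0 huk hE0 hEk hφ1 hφ2
  have hN := four_point_sq_le (v := g + (k - r) * (k - c) / (2 * k) - k / 2)
    (d := (k - r) * (k - c) / (2 * k * (k ^ 2 - t)))
    (x₁ := 1 - ((k - r) + (k - c) - 1) / (2 * k)) (x₂ := -((k - c) / (2 * k)))
    (x₃ := -((k - r) / (2 * k))) (x₄ := -(0 / (2 * k)))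
    (p₁ := (k - r) * (k - c) / (k ^ 2 - t)) (p₂ := (k - r) * c / (k ^ 2 - t))
    (p₃ := r * (k - c) / (k ^ 2 - t)) (p₄ := (r * c - t) / (k ^ 2 - t))
    (by positivity) (by positivity) (by positivity) (by positivity) hsum
    (hbbound _ (by linarith) (by linarith)).1 (hbbound _ (by linarith) (by linarith)).2
    (hbbound _ (by linarith) (by linarith)).2 (hbbound _ (by linarith) (by linarith)).2
    (by
      field_simp
      ring)
  have hdrift' : (g + (k - r) * (k - c) / (2 * k) - k / 2) *
      ((k - r) * (k - c) / (2 * k * (k ^ 2 - t))) ≤ 3 / 2 := by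
    have hd0 : 0 ≤ (k - r) * (k - c) / (2 * k * (k ^ 2 - t)) := by positivity
    have hd1 : (k - r) * (k - c) / (2 * k * (k ^ 2 - t)) ≤ 1 / k := by
      have hLk : L * k ≤ k / 2 * k := mul_le_mul_of_nonneg_right (by linarith) (by linarith)
      have hD2 : k * k ≤ 2 * (k ^ 2 - t) := by linarith [sq k]
      have hab : (k - r) * (k - c) ≤ k * k :=
        mul_le_mul (by linarith) (by linarith) hb (by linarith)
      rw [div_le_div_iff₀ (by positivity) (by positivity)]
      calc (k - r) * (k - c) * k ≤ 2 * (k ^ 2 - t) * k :=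
            mul_le_mul_of_nonneg_right (hab.trans hD2) (by linarith)
        _ = 1 * (2 * k * (k ^ 2 - t)) := by ring
    have hv : g + (k - r) * (k - c) / (2 * k) - k / 2 ≤ 3 / 2 * k := by
      have : (k - r) * (k - c) / (2 * k) = u / 2 := by
        rw [hu]
        field_simp
      linarith
    calc _ ≤ 3 / 2 * k * ((k - r) * (k - c) / (2 * k * (k ^ 2 - t))) := by gcongr
      _ ≤ 3 / 2 * k * (1 / k) := by gcongr
      _ = 3 / 2 := by field_simp
  have hV1 : emptyDev K (t + 1) (r + 1, c + 1, g + 1) =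
      u - E + (-(((k - r) + (k - c) - 1) / k) + E * φ) := by
    simp only [emptyDev, ← hkdef, hEsucc, hu]
    push_cast
    field_simp
    ring
  have hV2 : emptyDev K (t + 1) (r + 1, c, g) = u - E + (-((k - c) / k) + E * φ) := by
    simp only [emptyDev, ← hkdef, hEsucc, hu]
    push_cast
    field_simp
    ring
  have hV3 : emptyDev K (t + 1) (r, c + 1, g) = u - E + (-((k - r) / k) + E * φ) := by
    simp only [emptyDev, ← hkdef, hEsucc, hu]
    push_cast
    field_simp
    ring
  have hV4 : emptyDev K (t + 1) (r, c, g) = u - E + (-(0 / k) + E * φ) := by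
    simp only [emptyDev, ← hkdef, hEsucc, hu]
    ring
  have hN1 : invariantDev K (r + 1, c + 1, g + 1) =
      g + (k - r) * (k - c) / (2 * k) - k / 2 + (1 - ((k - r) + (k - c) - 1) / (2 * k)) := by
    simp only [invariantDev, ← hkdef]
    push_cast
    field_simp
    ring
  have hN2 : invariantDev K (r + 1, c, g) =
      g + (k - r) * (k - c) / (2 * k) - k / 2 + -((k - c) / (2 * k)) := by
    simp only [invariantDev, ← hkdef]
    push_cast
    field_simp
    ring
  have hN3 : invariantDev K (r, c + 1, g) =
      g + (k - r) * (k - c) / (2 * k) - k / 2 + -((k - r) / (2 * k)) := by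
    simp only [invariantDev, ← hkdef]
    push_cast
    field_simp
    ring
  have hN4 : invariantDev K (r, c, g) =
      g + (k - r) * (k - c) / (2 * k) - k / 2 + -(0 / (2 * k)) := by
    simp only [invariantDev, ← hkdef]
    ring
  have hF : lyapunov K t (r, c, g) =
      (u - E) ^ 2 + (g + (k - r) * (k - c) / (2 * k) - k / 2) ^ 2 := rfl
  simp only [lyapunov] at hF ⊢
  rw [hF, hV1, hV2, hV3, hV4, hN1, hN2, hN3, hN4]
  linarith

lemma HasChainLaw.lintegral_lyapunov_le {Ω : Type*} [MeasurableSpace Ω] {μ : Measure Ω}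
    [IsProbabilityMeasure μ] {X : ℕ → Ω → ℕ × ℕ × ℕ} {K t : ℕ} {L : ℝ} (h : HasChainLaw μ X K)
    (hX : ∀ u, Measurable (X u)) (hK : 2 ≤ K) (hKL : 2 * L ≤ K) (ht : 1 ≤ t) (htK : t ≤ K ^ 2)
    (htL : (t : ℝ) ≤ L * K) :
    ∫⁻ ω, ENNReal.ofReal (lyapunov K t (X t ω)) ∂μ ≤ ENNReal.ofReal ((8 * L + 29) * t) := by
  have hL : 0 < L := by
    have h1 : (1 : ℝ) ≤ t := by exact_mod_cast ht
    have h2 : (0 : ℝ) < K := by positivity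
    by_contra! hneg
    nlinarith
  induction t, ht using Nat.le_induction with
  | base =>
    have hbound : ∀ᵐ ω ∂μ, ENNReal.ofReal (lyapunov K 1 (X 1 ω)) ≤
        ENNReal.ofReal ((8 * L + 29) * (1 : ℕ)) := by
      filter_upwards [h.ae_start hX hK] with ω hω
      rw [hω]
      refine ENNReal.ofReal_le_ofReal ?_
      have hk : (1 : ℝ) ≤ K := by
        have : 1 ≤ K := by omega
        exact_mod_cast this
      obtain ⟨e1, e2⟩ := one_sub_exp_bounds hk
      simp only [lyapunov, emptyDev, invariantDev]
      set x : ℝ := 1 - Real.exp (-(2 / K)) with hx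
      have hi0 : 0 ≤ 1 / (K : ℝ) := by positivity
      have hi1 : 1 / (K : ℝ) ≤ 1 := by rwa [div_le_one (by positivity)]
      have hkx : K * x ≤ 2 := by
        calc K * x ≤ K * (2 / K) := by gcongr
          _ = 2 := by field_simp
      have hkx0 : 0 ≤ K * x := by
        have : Real.exp (-(2 / (K : ℝ))) ≤ 1 := Real.exp_le_one_iff.2 (by
          have : 0 ≤ 2 / (K : ℝ) := by positivity
          linarith)
        have : 0 ≤ x := by linarith
        positivity
      have hexp : Real.exp (-(2 / K) * ((1 : ℕ) : ℝ)) = 1 - x := by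
        rw [hx]
        simp
      have hv : ((K : ℝ) - (1 : ℕ)) * (K - (1 : ℕ)) / K -
          K * Real.exp (-(2 / K) * ((1 : ℕ) : ℝ)) = K * x - 2 + 1 / K := by
        rw [hexp]
        push_cast
        field_simp
        ring
      have hn : ((1 : ℕ) : ℝ) + ((K : ℝ) - (1 : ℕ)) * (K - (1 : ℕ)) / (2 * K) - K / 2 =
          1 / K / 2 := by
        push_cast
        field_simp
        ring
      rw [hv, hn]
      have hvsq : (K * x - 2 + 1 / K) ^ 2 ≤ 2 ^ 2 := by
        exact sq_le_sq' (by linarith) (by linarith)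
      have hnsq : (1 / (K : ℝ) / 2) ^ 2 ≤ 1 ^ 2 := by
        gcongr
        linarith
      push_cast
      linarith
    calc _ ≤ ∫⁻ _, ENNReal.ofReal ((8 * L + 29) * (1 : ℕ)) ∂μ := lintegral_mono_ae hbound
      _ = _ := by simp
  | succ t ht ih =>
    have htL' : (t : ℝ) ≤ L * K := by
      push_cast at htL
      linarith
    rw [h.lintegral_succ hX ht htK (fun s => ENNReal.ofReal (lyapunov K (t + 1) s))]
    have hstep : ∀ᵐ ω ∂μ, ∑' s', ENNReal.ofReal (transProb K t (X t ω) s') *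
        ENNReal.ofReal (lyapunov K (t + 1) s') ≤
        ENNReal.ofReal (lyapunov K t (X t ω)) + ENNReal.ofReal (8 * L + 29) := by
      filter_upwards [h.ae_reachable hX hK ht (by omega)] with ω hω
      generalize X t ω = s at hω
      obtain ⟨r, c, g⟩ := s
      have hpos : ∀ u s, 0 ≤ lyapunov K u s := fun u s => by
        unfold lyapunov
        positivity
      rw [hω.tsum_transProb_mul htK _ (hpos (t + 1)),
        ← ENNReal.ofReal_add (hpos _ _) (by positivity)]
      exact ENNReal.ofReal_le_ofReal (hω.lyapunov_step htK htL' hKL)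
    calc _ ≤ ∫⁻ ω, (ENNReal.ofReal (lyapunov K t (X t ω)) + ENNReal.ofReal (8 * L + 29)) ∂μ :=
          lintegral_mono_ae hstep
      _ = ∫⁻ ω, ENNReal.ofReal (lyapunov K t (X t ω)) ∂μ + ENNReal.ofReal (8 * L + 29) := by
          rw [lintegral_add_right _ measurable_const]
          simp
      _ ≤ ENNReal.ofReal ((8 * L + 29) * t) + ENNReal.ofReal (8 * L + 29) := by
          gcongr
          exact ih (by omega) htL'
      _ = _ := by
          rw [← ENNReal.ofReal_add (by positivity) (by positivity)]
          congr 1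
          push_cast
          ring

lemma HasChainLaw.measure_green_dev_le {Ω : Type*} [MeasurableSpace Ω] {μ : Measure Ω}
    [IsProbabilityMeasure μ] {X : ℕ → Ω → ℕ × ℕ × ℕ} {K t : ℕ} {L η : ℝ} (h : HasChainLaw μ X K)
    (hX : ∀ u, Measurable (X u)) (hK : 2 ≤ K) (hKL : 2 * L ≤ K) (ht : 1 ≤ t) (htK : t ≤ K ^ 2)
    (htL : (t : ℝ) ≤ L * K) (hη : 0 < η) :
    μ {ω | η * K ≤ |((X t ω).2.2 : ℝ) - K * ((1 - Real.exp (-(2 / K) * t)) / 2)|} ≤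
      ENNReal.ofReal (2 * (8 * L + 29) * L / η ^ 2 / K) := by
  have hK0 : (0 : ℝ) < K := by positivity
  have hsub : {ω | η * K ≤ |((X t ω).2.2 : ℝ) - K * ((1 - Real.exp (-(2 / K) * t)) / 2)|} ⊆
      {ω | ENNReal.ofReal (η ^ 2 * K ^ 2 / 2) ≤ ENNReal.ofReal (lyapunov K t (X t ω))} := by
    intro ω hω
    refine ENNReal.ofReal_le_ofReal ?_
    have hω' : η * K ≤ |invariantDev K (X t ω) - emptyDev K t (X t ω) / 2| := by
      refine le_of_le_of_eq hω (congrArg abs ?_)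
      unfold invariantDev emptyDev
      field_simp
      ring
    have hsq : (η * K) ^ 2 ≤ (invariantDev K (X t ω) - emptyDev K t (X t ω) / 2) ^ 2 := by
      rw [← sq_abs (invariantDev K (X t ω) - _)]
      gcongr
    unfold lyapunov
    nlinarith [sq_nonneg (invariantDev K (X t ω) + 2 * emptyDev K t (X t ω)),
      sq_nonneg (invariantDev K (X t ω)), sq_nonneg (emptyDev K t (X t ω))]
  have hpos : 0 < η ^ 2 * K ^ 2 / 2 := by positivity
  calc _ ≤ _ := measure_mono hsub
    _ ≤ (∫⁻ ω, ENNReal.ofReal (lyapunov K t (X t ω)) ∂μ) / ENNReal.ofReal (η ^ 2 * K ^ 2 / 2) :=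
        meas_ge_le_lintegral_div
          (((measurable_of_countable fun s => ENNReal.ofReal (lyapunov K t s)).comp
            (hX t)).aemeasurable) (by simpa using hpos) ENNReal.ofReal_ne_top
    _ ≤ ENNReal.ofReal ((8 * L + 29) * t) / ENNReal.ofReal (η ^ 2 * K ^ 2 / 2) := by
        gcongr
        exact h.lintegral_lyapunov_le hX hK hKL ht htK htL
    _ = ENNReal.ofReal ((8 * L + 29) * t / (η ^ 2 * K ^ 2 / 2)) :=
        (ENNReal.ofReal_div_of_pos hpos).symm
    _ ≤ _ := by
        refine ENNReal.ofReal_le_ofReal ?_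
        have hL : 0 < L := by
          have h1 : (1 : ℝ) ≤ t := by exact_mod_cast ht
          by_contra! hneg
          nlinarith
        calc (8 * L + 29) * t / (η ^ 2 * K ^ 2 / 2) ≤
            (8 * L + 29) * (L * K) / (η ^ 2 * K ^ 2 / 2) := by gcongr
          _ = _ := by field_simp

lemma tendsto_measure_green_dev {Ω : ℕ → Type*} [m : ∀ K, MeasurableSpace (Ω K)]
    {μ : ∀ K, Measure (Ω K)} [∀ K, IsProbabilityMeasure (μ K)]
    {X : ∀ K, ℕ → Ω K → ℕ × ℕ × ℕ} (hX : ∀ K t, Measurable (X K t))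
    (hlaw : ∀ K, 2 ≤ K → HasChainLaw (μ K) (X K) K) {y η : ℝ} (hy : 0 < y) (hη : 0 < η) :
    Tendsto (fun K : ℕ => μ K {ω | η ≤ |((X K ⌊y * K⌋₊ ω).2.2 : ℝ) / K -
      (1 - Real.exp (-2 * y)) / 2|}) atTop (nhds 0) := by
  have hfloor : Tendsto (fun K : ℕ => (⌊y * K⌋₊ : ℝ) / K) atTop (nhds y) :=
    (tendsto_nat_floor_mul_div_atTop hy.le).comp tendsto_natCast_atTop_atTop
  have hcont : Continuous fun x : ℝ => (1 - Real.exp (-2 * x)) / 2 := by fun_prop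
  have hg := (hcont.tendsto y).comp hfloor
  have hclose : ∀ᶠ K : ℕ in atTop, |(1 - Real.exp (-2 * ((⌊y * K⌋₊ : ℝ) / K))) / 2 -
      (1 - Real.exp (-2 * y)) / 2| < η / 2 :=
    (Metric.tendsto_nhds.1 hg (η / 2) (by positivity))
  have hbig : Tendsto (fun K : ℕ => y * (K : ℝ)) atTop atTop :=
    tendsto_natCast_atTop_atTop.const_mul_atTop hy
  have hlim : Tendsto (fun K : ℕ => ENNReal.ofReal (2 * (8 * y + 29) * y / (η / 2) ^ 2 / K))
      atTop (nhds 0) := by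
    rw [← ENNReal.ofReal_zero]
    exact ENNReal.tendsto_ofReal (tendsto_const_div_atTop_nhds_zero_nat _)
  refine tendsto_of_tendsto_of_tendsto_of_le_of_le' tendsto_const_nhds hlim
    (Eventually.of_forall fun _ => zero_le) ?_
  filter_upwards [hclose, hbig.eventually_ge_atTop 1, eventually_ge_atTop 2,
    tendsto_natCast_atTop_atTop.eventually_ge_atTop (2 * y)] with K h1 h2 hK hKy
  have hK0 : (0 : ℝ) < K := by positivity
  have htL : (⌊y * K⌋₊ : ℝ) ≤ y * K := Nat.floor_le (by positivity)
  have htK : ⌊y * K⌋₊ ≤ K ^ 2 := by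
    have : (⌊y * K⌋₊ : ℝ) ≤ (K : ℝ) ^ 2 := by nlinarith
    exact_mod_cast this
  refine le_trans (measure_mono ?_) ((hlaw K hK).measure_green_dev_le (hX K) hK hKy
    (Nat.one_le_floor_iff _ |>.2 h2) htK htL (show 0 < η / 2 by positivity))
  intro ω hω
  simp only [Set.mem_ofPred_eq] at hω ⊢
  have hexp : -(2 / (K : ℝ)) * (⌊y * K⌋₊ : ℝ) = -2 * ((⌊y * K⌋₊ : ℝ) / K) := by ring
  rw [hexp]
  set q : ℝ := (1 - Real.exp (-2 * ((⌊y * K⌋₊ : ℝ) / K))) / 2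
  have hfac : ((X K ⌊y * K⌋₊ ω).2.2 : ℝ) - K * q = (((X K ⌊y * K⌋₊ ω).2.2 : ℝ) / K - q) * K := by
    field_simp
  rw [hfac, abs_mul, abs_of_pos hK0]
  refine mul_le_mul_of_nonneg_right ?_ hK0.le
  have := abs_sub_le (((X K ⌊y * K⌋₊ ω).2.2 : ℝ) / K) q ((1 - Real.exp (-2 * y)) / 2)
  linarith

/-- A sequence climbing by steps of size at most one first hits `n` between a time where it lies
below `n` and a later time where it has reached `n`. -/
lemma sInf_hitting_mem_Ioc {x : ℕ → ℕ} {n a b : ℕ} (ha : 1 ≤ a) (hab : a ≤ b)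
    (hmono : ∀ t, 1 ≤ t → t < b → x t ≤ x (t + 1))
    (hstep : ∀ t, 1 ≤ t → t < b → x (t + 1) ≤ x t + 1) (hxa : x a < n) (hxb : n ≤ x b) :
    a < sInf {t | 1 ≤ t ∧ x t = n} ∧ sInf {t | 1 ≤ t ∧ x t = n} ≤ b := by
  have hex : ∀ t, a ≤ t → t ≤ b → n ≤ x t → ∃ u, 1 ≤ u ∧ u ≤ t ∧ x u = n := by
    intro t hat
    induction t, hat using Nat.le_induction with
    | base => exact fun _ h => absurd hxa (by omega)
    | succ t hat ih =>
      intro htb hn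
      rcases Nat.lt_or_ge (x t) n with hlt | hge
      · exact ⟨t + 1, by omega, le_rfl, by have := hstep t (by omega) (by omega); omega⟩
      · obtain ⟨u, h1, h2, h3⟩ := ih (by omega) hge
        exact ⟨u, h1, by omega, h3⟩
  obtain ⟨u, hu1, hub, hu⟩ := hex b hab le_rfl hxb
  have hle : ∀ t s, 1 ≤ t → t ≤ s → s ≤ b → x t ≤ x s := by
    intro t s ht hts
    induction s, hts using Nat.le_induction with
    | base => exact fun _ => le_rfl
    | succ s hts ih => exact fun hs => (ih (by omega)).trans (hmono s (by omega) (by omega))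
  have hmem : sInf {t | 1 ≤ t ∧ x t = n} ∈ {t | 1 ≤ t ∧ x t = n} := Nat.sInf_mem ⟨u, hu1, hu⟩
  refine ⟨?_, (Nat.sInf_le (show u ∈ {t | 1 ≤ t ∧ x t = n} from ⟨hu1, hu⟩)).trans hub⟩
  by_contra! hlt
  have := hle _ a hmem.1 hlt hab
  have := hmem.2
  omega

lemma HasChainLaw.ae_green_step {Ω : Type*} [MeasurableSpace Ω] {μ : Measure Ω}
    [IsProbabilityMeasure μ] {X : ℕ → Ω → ℕ × ℕ × ℕ} {K : ℕ} (h : HasChainLaw μ X K)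
    (hX : ∀ u, Measurable (X u)) (hK : 2 ≤ K) :
    ∀ᵐ ω ∂μ, ∀ t, 1 ≤ t → t < K ^ 2 →
      (X t ω).2.2 ≤ (X (t + 1) ω).2.2 ∧ (X (t + 1) ω).2.2 ≤ (X t ω).2.2 + 1 := by
  refine ae_all_iff.2 fun t => ?_
  by_cases ht : 1 ≤ t ∧ t < K ^ 2
  · filter_upwards [h.ae_reachable hX hK ht.1 ht.2.le, h.ae_transProb_pos hX ht.1 ht.2]
      with ω h1 h2 _ _
    exact (h1.succ ht.1 ht.2 h2).2
  · exact Eventually.of_forall fun ω h1 h2 => absurd ⟨h1, h2⟩ ht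

/-- For the incremental-construction Markov chain `(R_t, C_t, G_t)` of size `K`
(started at `(1,1,1)` at time `1`, with the transition probabilities `transProb`)
and the stopping time `τ_{εK} = inf{t ≥ 1 : G_t = ⌊εK⌋}`, the rescaled stopping
time `τ_{εK}/K` converges in probability to `(1/2)·log(1/(1-2ε))` as `K → ∞`. -/
theorem stmt12 (ε : ℝ) (hε1 : 0 < ε) (hε2 : ε < 1 / 2)
    (Ω : ℕ → Type*) [m : ∀ K, MeasurableSpace (Ω K)]
    (μ : ∀ K, Measure (Ω K)) [hμ : ∀ K, IsProbabilityMeasure (μ K)]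
    (X : ∀ K, ℕ → Ω K → ℕ × ℕ × ℕ)
    (hX : ∀ K t, Measurable (X K t))
    (hlaw : ∀ K, 2 ≤ K → ∀ T, 1 ≤ T → T ≤ K ^ 2 → ∀ traj : ℕ → ℕ × ℕ × ℕ,
      μ K {ω | ∀ t, 1 ≤ t → t ≤ T → X K t ω = traj t} =
        ENNReal.ofReal (if traj 1 = (1, 1, 1) then
          ∏ t ∈ Finset.Ico 1 T, transProb K t (traj t) (traj (t + 1)) else 0)) :
    ∀ δ : ℝ, 0 < δ →
      Tendsto (fun K : ℕ =>
          (μ K {ω |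
            δ ≤ |((sInf {t : ℕ | 1 ≤ t ∧ (X K t ω).2.2 = ⌊ε * K⌋₊} : ℕ) : ℝ) / K -
              1 / 2 * Real.log (1 / (1 - 2 * ε))|}).toReal)
        atTop (nhds 0) := by
  intro δ hδ
  have hlaw' : ∀ K, 2 ≤ K → HasChainLaw (μ K) (X K) K := hlaw
  set x : ℝ := 1 / 2 * Real.log (1 / (1 - 2 * ε)) with hx
  have hε3 : 0 < 1 - 2 * ε := by linarith
  have hx0 : 0 < x := by
    have : 0 < Real.log (1 / (1 - 2 * ε)) :=
      Real.log_pos (by rw [lt_div_iff₀ hε3]; linarith)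
    positivity
  have hgx : (1 - Real.exp (-2 * x)) / 2 = ε := by
    have : -2 * x = Real.log (1 - 2 * ε) := by
      rw [hx, one_div (1 - 2 * ε), Real.log_inv]
      ring
    rw [this, Real.exp_log hε3]
    ring
  have hgmono : ∀ a b : ℝ, a < b →
      (1 - Real.exp (-2 * a)) / 2 < (1 - Real.exp (-2 * b)) / 2 := by
    intro a b hab
    have := Real.exp_lt_exp.2 (show -2 * b < -2 * a by linarith)
    linarith
  obtain ⟨d, hd0, hdδ, hdx⟩ : ∃ d : ℝ, 0 < d ∧ d < δ ∧ d < x :=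
    ⟨min δ x / 2, by positivity, by have := min_le_left δ x; linarith,
      by have := min_le_right δ x; linarith⟩
  obtain ⟨y₁, hy₁⟩ : ∃ y, y = x - d := ⟨_, rfl⟩
  obtain ⟨y₂, hy₂⟩ : ∃ y, y = x + d := ⟨_, rfl⟩
  have hg₁ := hgmono y₁ x (by linarith)
  have hg₂ := hgmono x y₂ (by linarith)
  rw [hgx] at hg₁ hg₂
  set g₁ : ℝ := (1 - Real.exp (-2 * y₁)) / 2 with hg₁def
  set g₂ : ℝ := (1 - Real.exp (-2 * y₂)) / 2 with hg₂def
  obtain ⟨η, hη0, hη₁, hη₂⟩ : ∃ η : ℝ, 0 < η ∧ g₁ + 2 * η ≤ ε ∧ ε + η ≤ g₂ :=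
    ⟨min ((ε - g₁) / 2) (g₂ - ε), lt_min (by linarith) (by linarith),
      by have := min_le_left ((ε - g₁) / 2) (g₂ - ε); linarith,
      by have := min_le_right ((ε - g₁) / 2) (g₂ - ε); linarith⟩
  have hT₁ := tendsto_measure_green_dev hX hlaw' (show 0 < y₁ by linarith) hη0
  have hT₂ := tendsto_measure_green_dev hX hlaw' (show 0 < y₂ by linarith) hη0
  have hT := hT₁.add hT₂
  rw [add_zero] at hT
  have hmain : Tendsto (fun K : ℕ => μ K {ω |
      δ ≤ |((sInf {t : ℕ | 1 ≤ t ∧ (X K t ω).2.2 = ⌊ε * K⌋₊} : ℕ) : ℝ) / K - x|})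
      atTop (nhds 0) := by
    refine tendsto_of_tendsto_of_tendsto_of_le_of_le' tendsto_const_nhds hT
      (Eventually.of_forall fun _ => zero_le) ?_
    have hbig : Tendsto (fun K : ℕ => y₁ * (K : ℝ)) atTop atTop :=
      tendsto_natCast_atTop_atTop.const_mul_atTop (by linarith)
    have hbig' : Tendsto (fun K : ℕ => η * (K : ℝ)) atTop atTop :=
      tendsto_natCast_atTop_atTop.const_mul_atTop hη0
    filter_upwards [hbig.eventually_ge_atTop 1, hbig'.eventually_ge_atTop 1,
      eventually_ge_atTop 2, tendsto_natCast_atTop_atTop.eventually_ge_atTop y₂]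
      with K h1 h2 hK hKy
    have hK0 : (0 : ℝ) < K := by positivity
    refine le_trans (measure_mono_ae ?_) (measure_union_le _ _)
    filter_upwards [(hlaw' K hK).ae_green_step (hX K) hK] with ω hω hmem
    by_contra hnot
    have hnot' : ¬ (η ≤ |((X K ⌊y₁ * K⌋₊ ω).2.2 : ℝ) / K - g₁| ∨
        η ≤ |((X K ⌊y₂ * K⌋₊ ω).2.2 : ℝ) / K - g₂|) := hnot
    push Not at hnot'
    obtain ⟨c₁, c₂⟩ := hnot'
    have u₁ : ((X K ⌊y₁ * K⌋₊ ω).2.2 : ℝ) < (g₁ + η) * K := by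
      rw [← div_lt_iff₀ hK0]
      linarith [(abs_lt.1 c₁).2]
    have u₂ : (g₂ - η) * K < ((X K ⌊y₂ * K⌋₊ ω).2.2 : ℝ) := by
      rw [← lt_div_iff₀ hK0]
      linarith [(abs_lt.1 c₂).1]
    have hn₁ : (⌊ε * K⌋₊ : ℝ) ≤ ε * K := Nat.floor_le (by positivity)
    have hn₂ : ε * K < (⌊ε * K⌋₊ : ℝ) + 1 := Nat.lt_floor_add_one _
    have v₁ : (X K ⌊y₁ * K⌋₊ ω).2.2 < ⌊ε * K⌋₊ := by
      have : ((X K ⌊y₁ * K⌋₊ ω).2.2 : ℝ) < (⌊ε * K⌋₊ : ℝ) := by nlinarith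
      exact_mod_cast this
    have v₂ : ⌊ε * K⌋₊ ≤ (X K ⌊y₂ * K⌋₊ ω).2.2 := by
      have : (⌊ε * K⌋₊ : ℝ) ≤ ((X K ⌊y₂ * K⌋₊ ω).2.2 : ℝ) := by nlinarith
      exact_mod_cast this
    have hb : ⌊y₂ * K⌋₊ ≤ K ^ 2 := by
      refine Nat.floor_le_of_le ?_
      push_cast
      nlinarith
    obtain ⟨w₁, w₂⟩ := sInf_hitting_mem_Ioc (x := fun t => (X K t ω).2.2)
      (Nat.one_le_floor_iff _ |>.2 h1) (Nat.floor_mono (by gcongr; linarith))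
      (fun t ht ht' => (hω t ht (by omega)).1) (fun t ht ht' => (hω t ht (by omega)).2) v₁ v₂
    have hmem' : δ ≤ |((sInf {t : ℕ | 1 ≤ t ∧ (X K t ω).2.2 = ⌊ε * K⌋₊} : ℕ) : ℝ) / K - x| :=
      hmem
    generalize sInf {t : ℕ | 1 ≤ t ∧ (X K t ω).2.2 = ⌊ε * K⌋₊} = τ at w₁ w₂ hmem'
    have z₁ : y₁ ≤ (τ : ℝ) / K := by
      rw [le_div_iff₀ hK0]
      exact ((Nat.floor_lt (by linarith)).1 w₁).le
    have z₂ : (τ : ℝ) / K ≤ y₂ := by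
      rw [div_le_iff₀ hK0]
      exact (Nat.le_floor_iff (mul_nonneg (by linarith) hK0.le)).1 w₂
    have : |(τ : ℝ) / K - x| ≤ d := abs_le.2 ⟨by linarith, by linarith⟩
    linarith
  exact (ENNReal.tendsto_toReal ENNReal.zero_ne_top).comp hmain
end
end

section
/- Fix ε ∈ (0,1/2) and let h(t) = Σ_{i=1}^{t} ⌊i/2⌋. Let (c(K))_K and (r(K))_K be sequences of natural numbers such that, for all sufficiently large K, both c(K)/K and r(K)/K lie in the open interval (1 − √(1−2ε) − K^{−1/4}, 1 − √(1−2ε) + K^{−1/4}). Then lim_{K→∞} [ 1 + Σ_{ℓ=0}^{2K−2} (K − c(K)) / ((ℓ+1)K − h(ℓ+1)) · ∏_{t=1}^{ℓ} ( K − r(K)·1_{{t odd}} − c(K)·1_{{t even}} − ⌊t/2⌋ ) / ( tK − h(t) ) ] = exp(√(1−2ε)), where the empty product (ℓ = 0) equals 1. -/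
open Filter

/-- `h(t) = Σ_{i=1}^t ⌊i/2⌋`. -/
def hfun (t : ℕ) : ℕ := ∑ i ∈ Finset.Icc 1 t, i / 2

theorem four_mul_hfun_le (t : ℕ) : 4 * hfun t ≤ t ^ 2 := by
  induction t with
  | zero => simp [hfun]
  | succ n ih =>
    have h : hfun (n + 1) = hfun n + (n + 1) / 2 := by
      unfold hfun
      rw [Finset.sum_Icc_succ_top (by omega)]
    rw [h]
    obtain ⟨m, rfl | rfl⟩ : ∃ m, n = 2 * m ∨ n = 2 * m + 1 := ⟨n / 2, by omega⟩
    · have : (2 * m + 1) / 2 = m := by omega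
      rw [this]
      nlinarith
    · have h2 : (2 * m + 1 + 1) / 2 = m + 1 := by omega
      have h3 : (2 * m + 1) ^ 2 = 4 * (m ^ 2 + m) + 1 := by ring
      have h4 : hfun (2 * m + 1) ≤ m ^ 2 + m := by omega
      rw [h2]
      nlinarith

theorem half_mul_le_mul_sub_hfun {t K : ℕ} (h : t ≤ 2 * K) :
    (t : ℝ) * K / 2 ≤ (t : ℝ) * K - hfun t := by
  have h1 : (4 : ℝ) * hfun t ≤ (t : ℝ) ^ 2 := by exact_mod_cast four_mul_hfun_le t
  have h2 : (t : ℝ) ≤ 2 * K := by exact_mod_cast h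
  nlinarith [Nat.cast_nonneg (α := ℝ) t]

theorem tendsto_of_eventually_mem_Ioo_rpow {u : ℕ → ℝ} {a : ℝ}
    (h : ∀ᶠ K : ℕ in atTop,
      u K ∈ Set.Ioo (a - (K : ℝ) ^ (-(1 : ℝ) / 4)) (a + (K : ℝ) ^ (-(1 : ℝ) / 4))) :
    Tendsto u atTop (nhds a) := by
  have h0 : Tendsto (fun K : ℕ => (K : ℝ) ^ (-(1 : ℝ) / 4)) atTop (nhds 0) := by
    have := (tendsto_rpow_neg_atTop (y := 1 / 4) (by norm_num)).comp
      (tendsto_natCast_atTop_atTop (R := ℝ))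
    simpa [Function.comp_def, neg_div] using this
  refine tendsto_of_tendsto_of_tendsto_of_le_of_le' (by simpa using h0.const_sub a)
    (by simpa using h0.const_add a) ?_ ?_
  · filter_upwards [h] with K hK using hK.1.le
  · filter_upwards [h] with K hK using hK.2.le

theorem eventually_le_of_tendsto_div {u : ℕ → ℕ} {a : ℝ} (ha : a < 1)
    (h : Tendsto (fun K => (u K : ℝ) / K) atTop (nhds a)) :
    ∀ᶠ K : ℕ in atTop, (u K : ℝ) ≤ K := by
  filter_upwards [h.eventually_lt_const ha, eventually_gt_atTop 0] with K hK hpos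
  have : (0 : ℝ) < K := by exact_mod_cast hpos
  exact ((div_lt_one this).1 hK).le

theorem tendsto_div_mul_sub_const {f : ℕ → ℝ} {a b d : ℝ} (hb : b ≠ 0)
    (h : Tendsto (fun K : ℕ => f K / K) atTop (nhds a)) :
    Tendsto (fun K : ℕ => f K / (b * K - d)) atTop (nhds (a / b)) := by
  have hd : Tendsto (fun K : ℕ => b - d / (K : ℝ)) atTop (nhds b) := by
    simpa using (tendsto_const_div_atTop_nhds_zero_nat d).const_sub b
  refine (h.div hd hb).congr' ?_
  filter_upwards [eventually_gt_atTop 0] with K hpos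
  have hK : (K : ℝ) ≠ 0 := by exact_mod_cast hpos.ne'
  rw [Pi.div_apply, div_div, mul_sub, mul_div_cancel₀ _ hK, mul_comm b]

theorem tendsto_sub_sub_div {u : ℕ → ℕ} {s : ℝ} (d : ℝ)
    (h : Tendsto (fun K => (u K : ℝ) / K) atTop (nhds (1 - s))) :
    Tendsto (fun K : ℕ => ((K : ℝ) - u K - d) / K) atTop (nhds s) := by
  have := (h.const_sub 1).sub (tendsto_const_div_atTop_nhds_zero_nat d)
  rw [sub_sub_cancel, sub_zero] at this
  refine this.congr' ?_
  filter_upwards [eventually_gt_atTop 0] with K hpos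
  have hK : (K : ℝ) ≠ 0 := by exact_mod_cast hpos.ne'
  field_simp

theorem hasSum_pow_succ_div_factorial (s : ℝ) :
    HasSum (fun n : ℕ => s ^ (n + 1) / (n + 1).factorial) (Real.exp s - 1) := by
  have h := NormedSpace.expSeries_div_hasSum_exp s
  rw [← Real.exp_eq_exp_ℝ] at h
  simpa using (hasSum_nat_add_iff' 1).2 h

/-- The factor of index `t` in the product, for given `K`, `r` and `c`. -/
noncomputable def stepFactor (K r c t : ℕ) : ℝ :=
  ((K : ℝ) - (if Odd t then (r : ℝ) else 0) - (if Even t then (c : ℝ) else 0) - (t / 2 : ℕ)) /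
    ((t : ℝ) * K - hfun t)

theorem abs_stepFactor_le {K r c t : ℕ} (hK : 0 < K) (ht : 0 < t) (htK : t ≤ 2 * K)
    (hr : (r : ℝ) ≤ K) (hc : (c : ℝ) ≤ K) : |stepFactor K r c t| ≤ 2 / t := by
  have hK' : (0 : ℝ) < K := by exact_mod_cast hK
  have ht' : (0 : ℝ) < t := by exact_mod_cast ht
  have hden := half_mul_le_mul_sub_hfun htK
  have hpos : (0 : ℝ) < t * K / 2 := by positivity
  have hhalf : ((t / 2 : ℕ) : ℝ) ≤ K := by exact_mod_cast (by omega : t / 2 ≤ K)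
  have hnum : |(K : ℝ) - (if Odd t then (r : ℝ) else 0) - (if Even t then (c : ℝ) else 0) -
      (t / 2 : ℕ)| ≤ K := by
    have h0 : (0 : ℝ) ≤ (t / 2 : ℕ) := Nat.cast_nonneg _
    have h1 : (0 : ℝ) ≤ r := Nat.cast_nonneg _
    have h2 : (0 : ℝ) ≤ c := Nat.cast_nonneg _
    rw [abs_le]
    rcases Nat.even_or_odd t with he | ho
    · rw [if_neg (Nat.not_odd_iff_even.2 he), if_pos he]
      constructor <;> linarith
    · rw [if_pos ho, if_neg (Nat.not_even_iff_odd.2 ho)]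
      constructor <;> linarith
  rw [stepFactor, abs_div, abs_of_pos (hpos.trans_le hden)]
  calc _ ≤ (K : ℝ) / (t * K / 2) := by gcongr
    _ = 2 / t := by field_simp

theorem prod_Icc_div_cast (a : ℝ) (n : ℕ) :
    ∏ t ∈ Finset.Icc 1 n, a / (t : ℝ) = a ^ n / n.factorial := by
  induction n with
  | zero => simp
  | succ k ih =>
    rw [Finset.prod_Icc_succ_top (by omega), ih, div_mul_div_comm, ← pow_succ,
      Nat.factorial_succ, mul_comm (k + 1), Nat.cast_mul]

theorem tendsto_stepFactor {r c : ℕ → ℕ} {s : ℝ} {t : ℕ} (ht : 0 < t)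
    (hr : Tendsto (fun K => (r K : ℝ) / K) atTop (nhds (1 - s)))
    (hc : Tendsto (fun K => (c K : ℝ) / K) atTop (nhds (1 - s))) :
    Tendsto (fun K => stepFactor K (r K) (c K) t) atTop (nhds (s / t)) := by
  refine tendsto_div_mul_sub_const (by exact_mod_cast ht.ne') ?_
  rcases Nat.even_or_odd t with he | ho
  · simpa [he, Nat.not_odd_iff_even.2 he] using tendsto_sub_sub_div ((t / 2 : ℕ) : ℝ) hc
  · simpa [ho, Nat.not_even_iff_odd.2 ho] using tendsto_sub_sub_div ((t / 2 : ℕ) : ℝ) hr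

/-- The summand of index `l` in the sum, for given `K`, `r` and `c`. -/
noncomputable def basinTerm (K r c l : ℕ) : ℝ :=
  ((K : ℝ) - c) / (((l : ℝ) + 1) * K - hfun (l + 1)) *
    ∏ t ∈ Finset.Icc 1 l, stepFactor K r c t

theorem abs_basinTerm_le {K r c l : ℕ} (hK : 0 < K) (hl : l + 1 ≤ 2 * K)
    (hr : (r : ℝ) ≤ K) (hc : (c : ℝ) ≤ K) :
    |basinTerm K r c l| ≤ 2 * (2 ^ l / l.factorial) := by
  have hK' : (0 : ℝ) < K := by exact_mod_cast hK
  rw [basinTerm, abs_mul, Finset.abs_prod, ← prod_Icc_div_cast]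
  refine mul_le_mul ?_ (Finset.prod_le_prod (fun _ _ => abs_nonneg _) fun t ht => ?_)
    (Finset.prod_nonneg fun _ _ => abs_nonneg _) zero_le_two
  · have hden := half_mul_le_mul_sub_hfun hl
    push_cast at hden
    have hmul : (K : ℝ) / 2 ≤ ((l : ℝ) + 1) * K / 2 := by
      nlinarith [mul_nonneg (Nat.cast_nonneg (α := ℝ) l) hK'.le]
    have hc0 : (0 : ℝ) ≤ c := Nat.cast_nonneg _
    rw [abs_div, abs_of_nonneg (sub_nonneg.2 hc), abs_of_pos (by linarith),
      div_le_iff₀ (by linarith)]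
    linarith
  · rw [Finset.mem_Icc] at ht
    exact abs_stepFactor_le hK (by omega) (by omega) hr hc

theorem tendsto_basinTerm {r c : ℕ → ℕ} {s : ℝ} (l : ℕ)
    (hr : Tendsto (fun K => (r K : ℝ) / K) atTop (nhds (1 - s)))
    (hc : Tendsto (fun K => (c K : ℝ) / K) atTop (nhds (1 - s))) :
    Tendsto (fun K => basinTerm K (r K) (c K) l) atTop
      (nhds (s ^ (l + 1) / (l + 1).factorial)) := by
  have h1 : Tendsto (fun K : ℕ => ((K : ℝ) - c K) / (((l : ℝ) + 1) * K - hfun (l + 1))) atTop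
      (nhds (s / (l + 1))) :=
    tendsto_div_mul_sub_const (by positivity) (by simpa using tendsto_sub_sub_div 0 hc)
  have h2 := tendsto_finsetProd (Finset.Icc 1 l) fun t ht =>
    tendsto_stepFactor (Finset.mem_Icc.1 ht).1 hr hc
  rw [prod_Icc_div_cast] at h2
  have heq : s ^ (l + 1) / ((l + 1).factorial : ℝ) = s / (l + 1) * (s ^ l / l.factorial) := by
    rw [Nat.factorial_succ]
    push_cast
    field_simp
    ring
  rw [heq]
  exact h1.mul h2

theorem tendsto_sum_basinTerm {r c : ℕ → ℕ} {s : ℝ} (hs : 0 < s)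
    (hr : Tendsto (fun K => (r K : ℝ) / K) atTop (nhds (1 - s)))
    (hc : Tendsto (fun K => (c K : ℝ) / K) atTop (nhds (1 - s))) :
    Tendsto (fun K => ∑ l ∈ Finset.range (2 * K - 1), basinTerm K (r K) (c K) l) atTop
      (nhds (Real.exp s - 1)) := by
  have hsum : ∀ K, ∑ l ∈ Finset.range (2 * K - 1), basinTerm K (r K) (c K) l =
      ∑' l, if l ∈ Finset.range (2 * K - 1) then basinTerm K (r K) (c K) l else 0 := by
    intro K
    rw [tsum_eq_sum (s := Finset.range (2 * K - 1)) fun l hl => if_neg hl]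
    exact Finset.sum_congr rfl fun l hl => (if_pos hl).symm
  simp_rw [hsum]
  rw [← (hasSum_pow_succ_div_factorial s).tsum_eq]
  refine tendsto_tsum_of_dominated_convergence
    (bound := fun l : ℕ => 2 * (2 ^ l / l.factorial : ℝ))
    ((Real.summable_pow_div_factorial 2).mul_left 2) (fun l => ?_) ?_
  · refine (tendsto_basinTerm l hr hc).congr' ?_
    filter_upwards [eventually_gt_atTop l] with K hK
    rw [if_pos (Finset.mem_range.2 (by omega))]
  · have hs1 : 1 - s < 1 := by linarith
    filter_upwards [eventually_le_of_tendsto_div hs1 hr, eventually_le_of_tendsto_div hs1 hc,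
      eventually_gt_atTop 0] with K hrK hcK hK l
    split_ifs with hl
    · rw [Finset.mem_range] at hl
      exact abs_basinTerm_le hK (by omega) hrK hcK
    · rw [norm_zero]
      positivity

/-- Asymptotics of the conditional expected rescaled basin size of the `⌊εK⌋`-th
best equilibrium: if `c(K)/K` and `r(K)/K` eventually lie within `K^{-1/4}` of
`1 - √(1-2ε)`, then
`1 + Σ_{ℓ=0}^{2K-2} (K-c)/((ℓ+1)K-h(ℓ+1)) ∏_{t=1}^ℓ (K - r·1_{t odd} - c·1_{t even} - ⌊t/2⌋)/(tK-h(t))`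
converges to `exp(√(1-2ε))`. -/
theorem stmt16 (ε : ℝ) (hε1 : 0 < ε) (hε2 : ε < 1 / 2) (c r : ℕ → ℕ)
    (hc : ∀ᶠ K : ℕ in atTop,
      (c K : ℝ) / K ∈ Set.Ioo (1 - Real.sqrt (1 - 2 * ε) - (K : ℝ) ^ (-(1 : ℝ) / 4))
        (1 - Real.sqrt (1 - 2 * ε) + (K : ℝ) ^ (-(1 : ℝ) / 4)))
    (hr : ∀ᶠ K : ℕ in atTop,
      (r K : ℝ) / K ∈ Set.Ioo (1 - Real.sqrt (1 - 2 * ε) - (K : ℝ) ^ (-(1 : ℝ) / 4))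
        (1 - Real.sqrt (1 - 2 * ε) + (K : ℝ) ^ (-(1 : ℝ) / 4))) :
    Tendsto (fun K : ℕ =>
        1 + ∑ ℓ ∈ Finset.range (2 * K - 1),
          ((K : ℝ) - c K) / (((ℓ : ℝ) + 1) * K - hfun (ℓ + 1)) *
            ∏ t ∈ Finset.Icc 1 ℓ,
              ((K : ℝ) - (if Odd t then (r K : ℝ) else 0) -
                  (if Even t then (c K : ℝ) else 0) - (t / 2 : ℕ)) /
                ((t : ℝ) * K - hfun t))
      atTop (nhds (Real.exp (Real.sqrt (1 - 2 * ε)))) := by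
  have hs : 0 < Real.sqrt (1 - 2 * ε) := Real.sqrt_pos.2 (by linarith)
  have h := (tendsto_sum_basinTerm hs (tendsto_of_eventually_mem_Ioo_rpow hr)
    (tendsto_of_eventually_mem_Ioo_rpow hc)).const_add 1
  rw [add_sub_cancel] at h
  exact h
end
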